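/- arXiv:1602.02808 — 2 statements merged into one kernel-verified Lean document; each statement's English description precedes it below -/
import Mathlib

section
/- Let Ω_ℓ = (−ℓ, ℓ) ⊂ ℝ, γ > 0, and let u_ℓ be a minimizer of E_{Ω_ℓ}(u) = ∫_{−ℓ}^{ℓ} F(u') − γu over W₀^{1,q}(Ω_ℓ). Let x_ℓ ∈ [−ℓ, ℓ] be a point where the continuous representative of u_ℓ attains its maximum over [−ℓ, ℓ]. Then u_ℓ is non-decreasing on (−ℓ, x_ℓ) and non-increasing on (x_ℓ, ℓ). -/
open MeasureTheory Set

noncomputable section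

/-- A strong model of `W₀^{1,q}(−ℓ,ℓ)`: differentiable functions vanishing at `±ℓ` with
`u' ∈ L^q(−ℓ,ℓ)` and `u ∈ L¹(−ℓ,ℓ)` (functions are identified with their continuous
representatives). -/
def MemW01d (q ℓ : ℝ) (u : ℝ → ℝ) : Prop :=
  Differentiable ℝ u ∧ u (-ℓ) = 0 ∧ u ℓ = 0 ∧
    Integrable (fun x => |deriv u x| ^ q) (volume.restrict (Ioo (-ℓ) ℓ)) ∧
    Integrable u (volume.restrict (Ioo (-ℓ) ℓ))

/-- The one-dimensional energy `E_{Ω_ℓ}(u) = ∫_{−ℓ}^{ℓ} F(u') − γu`. -/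
def energy1 (F : ℝ → ℝ) (γ ℓ : ℝ) (u : ℝ → ℝ) : ℝ :=
  ∫ x in Ioo (-ℓ) ℓ, (F (deriv u x) - γ * u x)

/-- `u` is a minimizer of the energy `En` over the admissible class `S`. -/
def IsMinOn1d {X : Type*} (S : X → Prop) (En : X → ℝ) (u : X) : Prop :=
  S u ∧ ∀ v, S v → En u ≤ En v

lemma aux_cantor : ∃ c : ℝ → ℝ, ∃ T : ℝ, 0 < T ∧ Continuous c ∧ (∀ x, 0 ≤ c x ∧ c x ≤ 1) ∧
    (∀ x ≤ 0, c x = 0) ∧ (∀ x, T ≤ x → c x = 1) ∧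
    ∃ S : Set ℝ, S.Countable ∧ ∀ᵐ x : ℝ, c x ∈ S := by
  obtain ⟨D, hDc, hDd⟩ := TopologicalSpace.exists_countable_dense (Icc (0:ℝ) 1)
  have : Countable D := hDc.to_subtype
  have : Encodable D := Encodable.ofCountable D
  set ε : D → ℝ := fun s => (posSumOfEncodable (ε := 1) one_pos D).1 s with hε
  have hpos : ∀ s, 0 < ε s := (posSumOfEncodable (ε := 1) one_pos D).2.1
  obtain ⟨T, hT, -⟩ := (posSumOfEncodable (ε := 1) one_pos D).2.2
  change HasSum ε T at hT
  have hsum : Summable ε := hT.summable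
  let g : Icc (0:ℝ) 1 → ℝ := fun t => ∑' s : D, if (s : Icc (0:ℝ) 1) < t then ε s else 0
  have hgs : ∀ t : Icc (0:ℝ) 1, Summable (fun s : D => if (s : Icc (0:ℝ) 1) < t then ε s else 0) := by
    intro t
    refine Summable.of_nonneg_of_le (fun s => ?_) (fun s => ?_) hsum
    · split_ifs; exacts [(hpos s).le, le_rfl]
    · split_ifs; exacts [le_rfl, (hpos s).le]
  have hg0 : ∀ t, 0 ≤ g t := fun t => tsum_nonneg fun s => by
    split_ifs; exacts [(hpos s).le, le_rfl]
  have hgT : ∀ t, g t ≤ T := fun t => by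
    rw [← hT.tsum_eq]
    exact (hgs t).tsum_le_tsum (fun s => by split_ifs; exacts [le_rfl, (hpos s).le]) hsum
  -- the jump at `s`
  have hjump : ∀ (s : D) (r t : Icc (0:ℝ) 1), r ≤ s → (s : Icc (0:ℝ) 1) < t → g r + ε s ≤ g t := by
    intro s r t hrs hst
    have h1 : HasSum (fun s' : D => if s' = s then ε s else 0) (ε s) := hasSum_ite_eq s (ε s)
    have h2 := (hgs r).hasSum.add h1
    refine hasSum_le (fun s' => ?_) h2 (hgs t).hasSum
    by_cases h : s' = s
    · subst h
      simp [hst, not_lt.2 hrs]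
    · by_cases h' : (s' : Icc (0:ℝ) 1) < r
      · simp [h, h', h'.trans_le (hrs.trans hst.le)]
      · simp only [h, h', if_false, add_zero]
        split_ifs; exacts [(hpos s').le, le_rfl]
  have hjump' : ∀ (s : D) (t : Icc (0:ℝ) 1), g s + ε s ≤ T := by
    intro s _
    have h1 : HasSum (fun s' : D => if s' = s then ε s else 0) (ε s) := hasSum_ite_eq s (ε s)
    have h2 := (hgs s).hasSum.add h1
    refine hasSum_le (fun s' => ?_) h2 hT
    by_cases h : s' = s
    · subst h
      simp
    · simp only [h, if_false, add_zero]
      split_ifs; exacts [le_rfl, (hpos s').le]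
  have hmono : StrictMono g := by
    intro r t hrt
    obtain ⟨s, hs, hsD⟩ : ((Ioo r t) ∩ D).Nonempty :=
      hDd.inter_open_nonempty _ isOpen_Ioo (nonempty_Ioo.2 hrt)
    have := hjump ⟨s, hsD⟩ r t hs.1.le hs.2
    linarith [hpos ⟨s, hsD⟩]
  let C : ℝ → Icc (0:ℝ) 1 := fun x => sSup {t | g t ≤ x}
  have hCm : Monotone C := fun x y hxy => sSup_le_sSup fun t ht => le_trans ht hxy
  have hCg : ∀ t, C (g t) = t := by
    intro t
    have : {s | g s ≤ g t} = Iic t := by ext s; simp [hmono.le_iff_le]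
    simp only [C, this]
    exact isLUB_Iic.sSup_eq
  have hCc : Continuous C := hCm.continuous_of_surjective fun t => ⟨g t, hCg t⟩
  have hbot : g ⊥ = 0 := by
    simp [g]
  have hTpos : 0 < T := by
    have : (⊥ : Icc (0:ℝ) 1) < ⊤ := by exact bot_lt_top
    have := hmono this
    linarith [hgT ⊤]
  have hCJ : ∀ s : D, ∀ x ∈ Ioo (g s) (g s + ε s), C x = s := by
    intro s x hx
    apply le_antisymm
    · refine sSup_le fun t ht => ?_
      by_contra h
      have := hjump s s t le_rfl (not_le.1 h)
      exact absurd (lt_of_lt_of_le hx.2 this) (not_lt.2 ht)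
    · exact le_sSup hx.1.le
  have hdisj : Pairwise (Function.onFun Disjoint fun s : D => Ioo (g s) (g s + ε s)) := by
    intro s s' hne
    rw [Function.onFun, Set.disjoint_left]
    intro x hx hx'
    exact hne (Subtype.ext ((hCJ s x hx).symm.trans (hCJ s' x hx')))
  have hvol : volume (⋃ s : D, Ioo (g s) (g s + ε s)) = ENNReal.ofReal T := by
    rw [measure_iUnion hdisj (fun s => measurableSet_Ioo)]
    simp only [Real.volume_Ioo, add_sub_cancel_left]
    rw [← ENNReal.ofReal_tsum_of_nonneg (fun s => (hpos s).le) hsum, hT.tsum_eq]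
  have hsub : (⋃ s : D, Ioo (g s) (g s + ε s)) ⊆ Icc 0 T := by
    refine iUnion_subset fun s x hx => ⟨(hg0 s).trans hx.1.le, hx.2.le.trans (hjump' s s)⟩
  have hnull : volume (Icc 0 T \ (⋃ s : D, Ioo (g s) (g s + ε s))) = 0 := by
    rw [measure_sdiff hsub (MeasurableSet.iUnion fun s => measurableSet_Ioo).nullMeasurableSet
      (by rw [hvol]; exact ENNReal.ofReal_ne_top), hvol, Real.volume_Icc]
    simp
  have hC0 : ∀ x ≤ 0, C x = ⊥ := by
    intro x hx
    have h : C x ≤ C (g ⊥) := hCm (by rw [hbot]; exact hx)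
    rw [hCg] at h
    exact le_bot_iff.1 h
  have hC1 : ∀ x, T ≤ x → C x = ⊤ := by
    intro x hx
    have h : C (g ⊤) ≤ C x := hCm ((hgT _).trans hx)
    rw [hCg] at h
    exact top_le_iff.1 h
  refine ⟨fun x => (C x : ℝ), T, hTpos, continuous_subtype_val.comp hCc, fun x => (C x).2, ?_, ?_,
    insert 0 (insert 1 ((fun t : Icc (0:ℝ) 1 => (t : ℝ)) '' D)), ?_, ?_⟩
  · intro x hx; simp only [hC0 x hx]; rfl
  · intro x hx; simp only [hC1 x hx]; rfl
  · exact ((hDc.image _).insert _).insert _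
  · have : ∀ᵐ x : ℝ, x ∉ Icc 0 T \ (⋃ s : D, Ioo (g s) (g s + ε s)) :=
      measure_eq_zero_iff_ae_notMem.1 hnull
    filter_upwards [this] with x hx
    rcases le_total x 0 with h | h
    · left; simp only [hC0 x h]; rfl
    rcases le_total T x with h' | h'
    · right; left; simp only [hC1 x h']; rfl
    · right; right
      have : x ∈ ⋃ s : D, Ioo (g s) (g s + ε s) := by
        by_contra hh; exact hx ⟨⟨h, h'⟩, hh⟩
      obtain ⟨s, hs⟩ := mem_iUnion.1 this
      exact ⟨s, s.2, by rw [hCJ s x hs]⟩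

lemma aux_glue (f g : ℝ → ℝ) (p : ℝ) (hf : Differentiable ℝ f) (hg : Differentiable ℝ g)
    (h0 : f p = g p) (h1 : deriv f p = deriv g p) (x : ℝ) :
    HasDerivAt (fun x => if x ≤ p then f x else g x) (if x ≤ p then deriv f x else deriv g x) x := by
  rcases lt_trichotomy x p with h | h | h
  · rw [if_pos h.le]
    refine (hf x).hasDerivAt.congr_of_eventuallyEq ?_
    filter_upwards [Iio_mem_nhds h] with y hy
    rw [if_pos (le_of_lt hy)]
  · subst h
    rw [if_pos le_rfl]
    have hl : HasDerivWithinAt (fun y => if y ≤ x then f y else g y) (deriv f x) (Iic x) x :=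
      (hf x).hasDerivAt.hasDerivWithinAt.congr (fun y hy => if_pos hy) (if_pos le_rfl)
    have hr : HasDerivWithinAt (fun y => if y ≤ x then f y else g y) (deriv f x) (Ici x) x := by
      rw [h1]
      refine (hg x).hasDerivAt.hasDerivWithinAt.congr (fun y hy => ?_) (by simp [h0])
      rcases eq_or_lt_of_le (show x ≤ y from hy) with h | h
      · subst h; simp [h0]
      · rw [if_neg (not_le.2 h)]
    have := hl.union hr
    rwa [Iic_union_Ici, hasDerivWithinAt_univ] at this
  · rw [if_neg (not_le.2 h)]
    refine (hg x).hasDerivAt.congr_of_eventuallyEq ?_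
    filter_upwards [Ioi_mem_nhds h] with y hy
    rw [if_neg (not_le.2 hy)]

lemma aux_neg (q lam Lam γ ℓ : ℝ)
    (hq : 1 < q) (hlam : 0 < lam) (hLam : 0 < Lam) (hγ : 0 < γ) (hℓ : 0 < ℓ)
    (F : ℝ → ℝ)
    (hFgrowth : ∀ ξ : ℝ, lam * |ξ| ^ q ≤ F ξ ∧ F ξ ≤ Lam * |ξ| ^ q) :
    ∃ v, MemW01d q ℓ v ∧ energy1 F γ ℓ v < 0 := by
  obtain ⟨c, T, hT, hcc, hc01, hc0, hc1, S, hS, hcS⟩ := aux_cantor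
  set k : ℝ := 2 * T / ℓ with hk
  have hkpos : 0 < k := by positivity
  set h : ℝ → ℝ := fun x => c ((x + ℓ) * k) * c (-x * k) with hh
  have hhc : Continuous h := by fun_prop
  have hh0 : ∀ x, 0 ≤ h x := fun x => mul_nonneg (hc01 _).1 (hc01 _).1
  have hh1 : ∀ x, h x ≤ 1 := fun x => mul_le_one₀ (hc01 _).2 (hc01 _).1 (hc01 _).2
  have hhl : ∀ x ≤ -ℓ, h x = 0 := fun x hx => by
    simp only [hh]
    rw [hc0 ((x + ℓ) * k) (mul_nonpos_of_nonpos_of_nonneg (by linarith) hkpos.le), zero_mul]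
  have hhr : ∀ x, 0 ≤ x → h x = 0 := fun x hx => by
    simp only [hh]
    rw [hc0 (-x * k) (mul_nonpos_of_nonpos_of_nonneg (by linarith) hkpos.le), mul_zero]
  have hhm : h (-ℓ / 2) = 1 := by
    have e1 : (-ℓ / 2 + ℓ) * k = T := by rw [hk]; field_simp; ring
    have e2 : -(-ℓ / 2) * k = T := by rw [hk]; field_simp
    simp only [hh]
    rw [e1, e2, hc1 T le_rfl, one_mul]
  set P : ℝ → ℝ := fun x => ∫ y in (-ℓ)..x, h y with hP
  have hPd : ∀ x, HasDerivAt P (h x) x := fun x =>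
    intervalIntegral.integral_hasDerivAt_right (hhc.intervalIntegrable _ _)
      (hhc.stronglyMeasurableAtFilter _ _) hhc.continuousAt
  have hPdiff : Differentiable ℝ P := fun x => (hPd x).differentiableAt
  have hPm : Monotone P := by
    refine monotone_of_deriv_nonneg hPdiff fun x => ?_
    rw [(hPd x).deriv]; exact hh0 x
  have hPl : P (-ℓ) = 0 := by simp [hP]
  have hPll : P (-ℓ - ℓ) = 0 := by
    simp only [hP]
    rw [intervalIntegral.integral_congr (g := fun _ => 0)]
    · simp
    · intro x hx
      rw [uIcc_of_ge (by linarith)] at hx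
      exact hhl x hx.2
  have hP0 : P ℓ = P 0 := by
    have : P 0 + ∫ y in (0:ℝ)..ℓ, h y = P ℓ :=
      intervalIntegral.integral_add_adjacent_intervals (hhc.intervalIntegrable _ _)
        (hhc.intervalIntegrable _ _)
    rw [← this, intervalIntegral.integral_congr (g := fun _ => 0)]
    · simp
    · intro x hx
      rw [uIcc_of_le hℓ.le] at hx
      exact hhr x hx.1
  have hPpos : 0 < P 0 := by
    refine intervalIntegral.integral_pos (by linarith) hhc.continuousOn (fun x _ => hh0 x)
      ⟨-ℓ / 2, ⟨by linarith, by linarith⟩, by rw [hhm]; exact one_pos⟩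
  set w : ℝ → ℝ := fun x => P x - P (x - ℓ) with hw
  have hwd : ∀ x, HasDerivAt w (h x - h (x - ℓ)) x := fun x => by
    refine (hPd x).sub ?_
    exact (hPd (x - ℓ)).comp_sub_const x ℓ
  have hwc : Continuous w := by
    have := hPdiff.continuous
    fun_prop
  have hw0 : ∀ x, 0 ≤ w x := fun x => sub_nonneg.2 (hPm (by linarith))
  have hwint : ∀ a b, IntervalIntegrable w volume a b := fun a b => hwc.intervalIntegrable _ _
  set W0 : ℝ := ∫ x in (-ℓ)..ℓ, w x with hW0
  have hW0pos : 0 < W0 := by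
    refine intervalIntegral.integral_pos (by linarith) hwc.continuousOn (fun x _ => hw0 x)
      ⟨0, ⟨by linarith, by linarith⟩, ?_⟩
    have : w 0 = P 0 := by simp [hw, hPl]
    rw [this]; exact hPpos
  set t : ℝ := (γ * W0 / (4 * Lam * ℓ)) ^ (1 / (q - 1)) with ht
  have hbase : 0 < γ * W0 / (4 * Lam * ℓ) := by positivity
  have htpos : 0 < t := Real.rpow_pos_of_pos hbase _
  have htq : t ^ q = t * (γ * W0 / (4 * Lam * ℓ)) := by
    have h1 : t ^ (q - 1) = γ * W0 / (4 * Lam * ℓ) := by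
      rw [ht, ← Real.rpow_mul hbase.le, one_div, inv_mul_cancel₀ (by linarith), Real.rpow_one]
    rw [← h1]
    nth_rewrite 2 [← Real.rpow_one t]
    rw [← Real.rpow_add htpos]; congr 1; ring
  set d : ℝ → ℝ := fun x => t * (h x - h (x - ℓ)) with hd
  have hdc : Continuous d := by fun_prop
  have hvd : ∀ x, HasDerivAt (fun x => t * w x) (d x) x := fun x => (hwd x).const_mul t
  have hdd : deriv (fun x => t * w x) = d := funext fun x => (hvd x).deriv
  have hdb : ∀ x, |d x| ≤ t := fun x => by
    simp only [hd]
    rw [abs_mul, abs_of_pos htpos]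
    have : |h x - h (x - ℓ)| ≤ 1 := by
      rw [abs_le]; constructor <;> linarith [hh0 x, hh1 x, hh0 (x - ℓ), hh1 (x - ℓ)]
    nlinarith
  have hdq : ∀ x, |d x| ^ q ≤ t ^ q := fun x =>
    Real.rpow_le_rpow (abs_nonneg _) (hdb x) (by linarith)
  have hle : -ℓ ≤ ℓ := by linarith
  -- a.e. countably valued
  obtain ⟨S', hS', hdS⟩ : ∃ S' : Set ℝ, S'.Countable ∧ ∀ᵐ x : ℝ, d x ∈ S' := by
    have haff : ∀ a b : ℝ, a ≠ 0 → ∀ᵐ x : ℝ, c (a * x + b) ∈ S := by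
      intro a b ha
      have h1 : Measure.QuasiMeasurePreserving (fun x : ℝ => a * x) volume volume := by
        refine ⟨by fun_prop, ?_⟩
        rw [Real.map_volume_mul_left ha]
        exact Measure.smul_absolutelyContinuous
      have h2 : Measure.QuasiMeasurePreserving (fun x : ℝ => x + b) volume volume :=
        (measurePreserving_add_right volume b).quasiMeasurePreserving
      exact (h2.comp h1).ae hcS
    have a1 := haff k (ℓ * k) hkpos.ne'
    have a2 := haff (-k) 0 (neg_ne_zero.2 hkpos.ne')
    have a3 := haff k 0 hkpos.ne'
    have a4 := haff (-k) (ℓ * k) (neg_ne_zero.2 hkpos.ne')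
    refine ⟨(fun z : (ℝ × ℝ) × (ℝ × ℝ) => t * (z.1.1 * z.1.2 - z.2.1 * z.2.2)) ''
      ((S ×ˢ S) ×ˢ (S ×ˢ S)), ((hS.prod hS).prod (hS.prod hS)).image _, ?_⟩
    filter_upwards [a1, a2, a3, a4] with x h1 h2 h3 h4
    refine ⟨((_, _), (_, _)), ⟨⟨h1, h2⟩, ⟨h3, h4⟩⟩, ?_⟩
    simp only [hd, hh]
    ring_nf
  have hFm : AEStronglyMeasurable (fun x => F (d x)) (volume.restrict (Ioo (-ℓ) ℓ)) := by
    have hG : Measurable (S'.indicator F) :=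
      measurable_zero.measurable_of_countable_ne (hS'.mono fun x hx => by
        by_contra hxS
        exact hx (by simp [hxS]))
    refine AEStronglyMeasurable.mono_measure ?_ Measure.restrict_le_self
    refine ((hG.comp hdc.measurable).aestronglyMeasurable).congr ?_
    filter_upwards [hdS] with x hx
    simp [hx]
  have hF0 : ∀ ξ, 0 ≤ F ξ := fun ξ => le_trans (by positivity) (hFgrowth ξ).1
  have hFb : ∀ x, F (d x) ≤ Lam * t ^ q := fun x =>
    (hFgrowth _).2.trans (mul_le_mul_of_nonneg_left (hdq x) hLam.le)
  have hFi : Integrable (fun x => F (d x)) (volume.restrict (Ioo (-ℓ) ℓ)) := by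
    refine Integrable.of_bound hFm (Lam * t ^ q) (Filter.Eventually.of_forall fun x => ?_)
    rw [Real.norm_of_nonneg (hF0 _)]; exact hFb x
  have hwi : Integrable (fun x => t * w x) (volume.restrict (Ioo (-ℓ) ℓ)) := by
    have := (hwint (-ℓ) ℓ).const_mul t
    rwa [intervalIntegrable_iff_integrableOn_Ioo_of_le hle] at this
  refine ⟨fun x => t * w x, ⟨fun x => (hvd x).differentiableAt, ?_, ?_, ?_, hwi⟩, ?_⟩
  · simp [hw, hPl, hPll]
  · simp [hw, hP0]
  · rw [hdd]
    have : Continuous fun x => |d x| ^ q :=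
      hdc.abs.rpow_const fun x => Or.inr (by linarith)
    have := this.intervalIntegrable (μ := volume) (-ℓ) ℓ
    rwa [intervalIntegrable_iff_integrableOn_Ioo_of_le hle] at this
  · unfold energy1
    rw [hdd, integral_sub hFi (hwi.const_mul γ), integral_const_mul, integral_const_mul,
      ← integral_Ioc_eq_integral_Ioo (f := w), ← intervalIntegral.integral_of_le hle, ← hW0]
    have h1 : ∫ x in Ioo (-ℓ) ℓ, F (d x) ≤ ∫ x in Ioo (-ℓ) ℓ, Lam * t ^ q :=
      integral_mono hFi (integrable_const _) hFb
    have h2 : ∫ x in Ioo (-ℓ) ℓ, Lam * t ^ q = γ * (t * W0) / 2 := by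
      rw [setIntegral_const, htq, Measure.real, Real.volume_Ioo,
        ENNReal.toReal_ofReal (by linarith), smul_eq_mul]
      field_simp; ring
    have : 0 < γ * (t * W0) := by positivity
    linarith

lemma aux_mono (q lam Lam γ ℓ : ℝ)
    (hq : 1 < q) (hlam : 0 < lam) (hLam : 0 < Lam) (hγ : 0 < γ) (hℓ : 0 < ℓ)
    (F : ℝ → ℝ)
    (hFgrowth : ∀ ξ : ℝ, lam * |ξ| ^ q ≤ F ξ ∧ F ξ ≤ Lam * |ξ| ^ q)
    (u : ℝ → ℝ)
    (hu : IsMinOn1d (MemW01d q ℓ) (energy1 F γ ℓ) u)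
    (hupos : ∀ x ∈ Ioo (-ℓ) ℓ, 0 ≤ u x)
    (x₀ : ℝ) (hx₀ : x₀ ∈ Icc (-ℓ) ℓ) (hmax : IsMaxOn u (Icc (-ℓ) ℓ) x₀) :
    MonotoneOn u (Ioo (-ℓ) x₀) := by
  obtain ⟨⟨hud, hul, hur, huq, hui⟩, hmin⟩ := hu
  have huc : Continuous u := hud.continuous
  have hle : -ℓ ≤ ℓ := by linarith
  have hF0 : ∀ ξ, 0 ≤ F ξ := fun ξ => le_trans (by positivity) (hFgrowth ξ).1
  have hq0 : (|0| : ℝ) ^ q = 0 := by rw [abs_zero]; exact Real.zero_rpow (by linarith)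
  have hFz : F 0 = 0 := by
    have := hFgrowth 0
    rw [hq0] at this
    linarith [this.1, this.2]
  -- integrability of the gradient term
  have hFi : Integrable (fun x => F (deriv u x)) (volume.restrict (Ioo (-ℓ) ℓ)) := by
    by_contra hni
    have hE : energy1 F γ ℓ u = 0 := by
      refine integral_undef fun hI => hni ?_
      have := hI.add (hui.const_mul γ)
      refine this.congr (Filter.Eventually.of_forall fun x => ?_)
      simp
    obtain ⟨v, hv, hneg⟩ := aux_neg q lam Lam γ ℓ hq hlam hLam hγ hℓ F hFgrowth
    linarith [hmin v hv]
  intro s hs t ht hst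
  by_contra hlt
  rw [not_le] at hlt
  have htℓ : t ∈ Ioo (-ℓ) ℓ := ⟨ht.1, ht.2.trans_le hx₀.2⟩
  have hut := hupos t htℓ
  -- the point `a`
  obtain ⟨a, haI, hamax⟩ := isCompact_Icc.exists_isMaxOn (nonempty_Icc.2 ht.1.le)
    (huc.continuousOn (s := Icc (-ℓ) t))
  have hsa : u s ≤ u a := hamax ⟨hs.1.le, hst⟩
  have hat : a < t := lt_of_le_of_ne haI.2 (by rintro rfl; linarith)
  have hla : -ℓ < a := lt_of_le_of_ne haI.1 (by rintro rfl; linarith)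
  have hda : deriv u a = 0 :=
    (hamax.isLocalMax (Icc_mem_nhds hla hat)).deriv_eq_zero
  set c := u a with hc
  have hutc : u t < c := by linarith
  -- the point `b`
  let B : Set ℝ := Icc t x₀ ∩ {x | c ≤ u x}
  have hBc : IsClosed B := isClosed_Icc.inter (isClosed_le continuous_const huc)
  have hBne : B.Nonempty :=
    ⟨x₀, ⟨ht.2.le, le_rfl⟩, hmax ⟨hla.le, (hat.trans htℓ.2).le⟩⟩
  have hBb : BddBelow B := ⟨t, fun x hx => hx.1.1⟩
  set b := sInf B with hb
  have hbB : b ∈ B := hBc.csInf_mem hBne hBb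
  have hlow : ∀ x, t ≤ x → x < b → u x < c := by
    intro x hx hxb
    by_contra h
    exact absurd (csInf_le hBb (show x ∈ B from ⟨⟨hx, hxb.le.trans hbB.1.2⟩, not_lt.1 h⟩))
      (not_le.2 hxb)
  have htb : t < b := lt_of_le_of_ne hbB.1.1 (by
    intro h
    have h2 : c ≤ u b := hbB.2
    rw [← h] at h2; linarith)
  have hub : u b = c := by
    refine le_antisymm ?_ hbB.2
    have : b ∈ closure (Ioo t b) := by
      rw [closure_Ioo htb.ne]; exact ⟨htb.le, le_rfl⟩
    exact closure_minimal (fun x hx => (hlow x hx.1.le hx.2).le : Ioo t b ⊆ {x | u x ≤ c})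
      (isClosed_le huc continuous_const) this
  have hbℓ : b ≤ ℓ := hbB.1.2.trans hx₀.2
  have hab : a < b := hat.trans htb
  have hule : ∀ x ∈ Icc a b, u x ≤ c := by
    intro x hx
    rcases le_total x t with h | h
    · exact hamax ⟨hla.le.trans hx.1, h⟩
    · rcases eq_or_lt_of_le hx.2 with h' | h'
      · rw [h', hub]
      · exact (hlow x h h').le
  clear_value b c
  clear hb
  set m := (a + b) / 2 with hm
  have ham : a < m := by rw [hm]; linarith
  have hmb : m < b := by rw [hm]; linarith
  -- the competitor
  let z : ℝ → ℝ := fun x => (c + u (2 * x - b)) / 2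
  have hzd : ∀ x, HasDerivAt z (deriv u (2 * x - b)) x := by
    intro x
    have h1 : HasDerivAt (fun x : ℝ => 2 * x - b) 2 x := by
      simpa using ((hasDerivAt_id x).const_mul 2).sub_const b
    have h2 := (hud (2 * x - b)).hasDerivAt.comp x h1
    have h3 := (h2.const_add c).div_const 2
    rw [mul_div_cancel_right₀ _ (two_ne_zero : (2:ℝ) ≠ 0)] at h3
    exact h3
  let v1 : ℝ → ℝ := fun x => if x ≤ a then u x else c
  have hv1 : ∀ x, HasDerivAt v1 (if x ≤ a then deriv u x else 0) x := by
    intro x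
    have := aux_glue u (fun _ => c) a hud (differentiable_const c) hc.symm
      (by simp [hda]) x
    simpa using this
  let v2 : ℝ → ℝ := fun x => if x ≤ m then v1 x else z x
  have hzm : 2 * m - b = a := by rw [hm]; ring
  have hv2 : ∀ x, HasDerivAt v2
      (if x ≤ m then (if x ≤ a then deriv u x else 0) else deriv u (2 * x - b)) x := by
    intro x
    have := aux_glue v1 z m (fun y => (hv1 y).differentiableAt) (fun y => (hzd y).differentiableAt)
      (by simp only [v1, z, hzm, if_neg (not_le.2 ham), ← hc]; ring)
      (by rw [(hv1 m).deriv, (hzd m).deriv, if_neg (not_le.2 ham), hzm, hda]) x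
    rwa [(hv1 x).deriv, (hzd x).deriv] at this
  let v : ℝ → ℝ := fun x => if x ≤ b then v2 x else u x
  let d : ℝ → ℝ := fun x => if x ≤ b then
    (if x ≤ m then (if x ≤ a then deriv u x else 0) else deriv u (2 * x - b)) else deriv u x
  have h2b : 2 * b - b = b := by ring
  have hvb : v2 b = u b := by
    simp only [v2, z, if_neg (not_le.2 hmb), h2b, hub]; ring
  have hvd : ∀ x, HasDerivAt v (d x) x := by
    intro x
    have := aux_glue v2 u b (fun y => (hv2 y).differentiableAt) hud hvb
      (by rw [(hv2 b).deriv, if_neg (not_le.2 hmb), h2b]) x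
    rwa [(hv2 x).deriv] at this
  have hdv : deriv v = d := funext fun x => (hvd x).deriv
  have hvdiff : Differentiable ℝ v := fun x => (hvd x).differentiableAt
  -- values of `v` and `d` on the pieces
  have hd1 : ∀ x ∈ Ioo (-ℓ) a, d x = deriv u x ∧ v x = u x := by
    intro x hx
    have e1 : x ≤ a := hx.2.le
    have e2 : x ≤ m := by linarith
    have e3 : x ≤ b := by linarith
    simp only [d, v, v2, v1, if_pos e1, if_pos e2, if_pos e3, and_self]
  have hd2 : ∀ x ∈ Ioo a m, d x = 0 ∧ v x = c := by
    intro x hx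
    have e1 : ¬ x ≤ a := not_le.2 hx.1
    have e2 : x ≤ m := hx.2.le
    have e3 : x ≤ b := by linarith
    simp only [d, v, v2, v1, if_neg e1, if_pos e2, if_pos e3, and_self]
  have hd3 : ∀ x ∈ Ioo m b, d x = deriv u (2 * x - b) ∧ v x = z x := by
    intro x hx
    have e2 : ¬ x ≤ m := not_le.2 hx.1
    have e3 : x ≤ b := hx.2.le
    simp only [d, v, v2, if_neg e2, if_pos e3, and_self]
  have hd4 : ∀ x ∈ Ioo b ℓ, d x = deriv u x ∧ v x = u x := by
    intro x hx
    have e3 : ¬ x ≤ b := not_le.2 hx.1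
    simp only [d, v, if_neg e3, and_self]
  -- general integration formula
  have key : ∀ G : ℝ → ℝ → ℝ, IntervalIntegrable (fun x => G (deriv u x) (u x)) volume (-ℓ) ℓ →
      IntervalIntegrable (fun x => G (deriv u x) ((c + u x) / 2)) volume a b →
      IntervalIntegrable (fun x => G (d x) (v x)) volume (-ℓ) ℓ ∧
      ∫ x in (-ℓ)..ℓ, G (d x) (v x) = (∫ x in (-ℓ)..ℓ, G (deriv u x) (u x))
        - (∫ x in a..b, G (deriv u x) (u x)) + (b - a) / 2 * G 0 c
        + (∫ x in a..b, G (deriv u x) ((c + u x) / 2)) / 2 := by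
    intro G hG hG'
    have sub : ∀ p r, -ℓ ≤ p → p ≤ r → r ≤ ℓ →
        IntervalIntegrable (fun x => G (deriv u x) (u x)) volume p r := fun p r h1 h2 h3 =>
      hG.mono_set (by rw [uIcc_of_le h2, uIcc_of_le hle]; exact Icc_subset_Icc h1 h3)
    have k1 := sub (-ℓ) a le_rfl hla.le (by linarith)
    have k2 := sub a b hla.le hab.le hbℓ
    have k3 := sub b ℓ (by linarith) hbℓ le_rfl
    have kz : IntervalIntegrable (fun x => G (deriv u (2 * x - b)) (z x)) volume m b := by
      have := (hG'.comp_sub_right b).comp_mul_left (c := 2)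
      have e : (b + b) / 2 = b := by ring
      rw [e] at this
      exact this
    have E1 : EqOn (fun x => G (deriv u x) (u x)) (fun x => G (d x) (v x)) (Ioo (-ℓ) a) :=
      fun x hx => by simp only [(hd1 x hx).1, (hd1 x hx).2]
    have E2 : EqOn (fun x => G 0 c) (fun x => G (d x) (v x)) (Ioo a m) :=
      fun x hx => by simp only [(hd2 x hx).1, (hd2 x hx).2]
    have E3 : EqOn (fun x => G (deriv u (2 * x - b)) (z x)) (fun x => G (d x) (v x)) (Ioo m b) :=
      fun x hx => by simp only [(hd3 x hx).1, (hd3 x hx).2]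
    have E4 : EqOn (fun x => G (deriv u x) (u x)) (fun x => G (d x) (v x)) (Ioo b ℓ) :=
      fun x hx => by simp only [(hd4 x hx).1, (hd4 x hx).2]
    have i1 : IntervalIntegrable (fun x => G (d x) (v x)) volume (-ℓ) a :=
      k1.congr_uIoo (by rwa [uIoo_of_le hla.le])
    have i2 : IntervalIntegrable (fun x => G (d x) (v x)) volume a m :=
      (intervalIntegrable_const (c := G 0 c)).congr_uIoo (by rwa [uIoo_of_le ham.le])
    have i3 : IntervalIntegrable (fun x => G (d x) (v x)) volume m b :=
      kz.congr_uIoo (by rwa [uIoo_of_le hmb.le])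
    have i4 : IntervalIntegrable (fun x => G (d x) (v x)) volume b ℓ :=
      k3.congr_uIoo (by rwa [uIoo_of_le hbℓ])
    refine ⟨((i1.trans i2).trans i3).trans i4, ?_⟩
    rw [← intervalIntegral.integral_add_adjacent_intervals ((i1.trans i2).trans i3) i4,
      ← intervalIntegral.integral_add_adjacent_intervals (i1.trans i2) i3,
      ← intervalIntegral.integral_add_adjacent_intervals i1 i2,
      ← intervalIntegral.integral_add_adjacent_intervals (k1.trans k2) k3,
      ← intervalIntegral.integral_add_adjacent_intervals k1 k2,
      ← intervalIntegral.integral_congr_Ioo_of_le hla.le E1,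
      ← intervalIntegral.integral_congr_Ioo_of_le ham.le E2,
      ← intervalIntegral.integral_congr_Ioo_of_le hmb.le E3,
      ← intervalIntegral.integral_congr_Ioo_of_le hbℓ E4]
    have := intervalIntegral.integral_comp_mul_sub (a := m) (b := b)
      (fun x => G (deriv u x) ((c + u x) / 2)) (two_ne_zero : (2:ℝ) ≠ 0) b
    simp only [hzm, h2b, smul_eq_mul] at this
    simp only [z]
    rw [this, intervalIntegral.integral_const, smul_eq_mul, hm]
    ring
  have toI : ∀ f : ℝ → ℝ, Integrable f (volume.restrict (Ioo (-ℓ) ℓ)) ↔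
      IntervalIntegrable f volume (-ℓ) ℓ := fun f =>
    (intervalIntegrable_iff_integrableOn_Ioo_of_le hle).symm
  have hsubab : uIcc a b ⊆ uIcc (-ℓ) ℓ := by
    rw [uIcc_of_le hab.le, uIcc_of_le hle]; exact Icc_subset_Icc hla.le hbℓ
  have huqI := (toI _).1 huq
  have hFiI := (toI _).1 hFi
  have hFab := hFiI.mono_set hsubab
  have huI : ∀ p r, IntervalIntegrable u volume p r := fun p r => huc.intervalIntegrable _ _
  have hzI : IntervalIntegrable (fun x => γ * ((c + u x) / 2)) volume a b := by
    apply Continuous.intervalIntegrable; fun_prop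
  have hmem : MemW01d q ℓ v := by
    refine ⟨hvdiff, ?_, ?_, ?_, ?_⟩
    · have e1 : -ℓ ≤ a := hla.le
      have e2 : -ℓ ≤ m := by linarith
      have e3 : -ℓ ≤ b := by linarith
      simp only [v, v2, v1, if_pos e1, if_pos e2, if_pos e3, hul]
    · by_cases h : ℓ ≤ b
      · have : ℓ = b := le_antisymm h hbℓ
        have e : v ℓ = v2 ℓ := if_pos h
        rw [e, this, hvb, ← this, hur]
      · simp only [v, if_neg h, hur]
    · rw [toI, hdv]
      exact (key (fun ξ _ => |ξ| ^ q) huqI (huqI.mono_set hsubab)).1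
    · rw [toI]; exact hvdiff.continuous.intervalIntegrable _ _
  have hk := (key (fun ξ y => F ξ - γ * y) (hFiI.sub ((huI _ _).const_mul γ)) (hFab.sub hzI)).2
  have hEe : ∀ y : ℝ → ℝ, energy1 F γ ℓ y = ∫ x in (-ℓ)..ℓ, (F (deriv y x) - γ * y x) := by
    intro y
    rw [energy1, intervalIntegral.integral_of_le hle, integral_Ioc_eq_integral_Ioo]
  have hcomp := hmin v hmem
  rw [hEe, hEe, hdv, hk, intervalIntegral.integral_sub hFab ((huI _ _).const_mul γ),
    intervalIntegral.integral_sub hFab hzI, intervalIntegral.integral_const_mul,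
    intervalIntegral.integral_const_mul, intervalIntegral.integral_div,
    intervalIntegral.integral_add intervalIntegrable_const (huI _ _),
    intervalIntegral.integral_const, smul_eq_mul, hFz] at hcomp
  have hFnn : 0 ≤ ∫ x in a..b, F (deriv u x) :=
    intervalIntegral.integral_nonneg hab.le fun x _ => hF0 _
  have hstrict : 0 < ∫ x in a..b, (c - u x) :=
    intervalIntegral.integral_pos hab (by fun_prop)
      (fun x hx => sub_nonneg.2 (hule x ⟨hx.1.le, hx.2⟩))
      ⟨t, ⟨hat.le, htb.le⟩, sub_pos.2 hutc⟩
  rw [intervalIntegral.integral_sub intervalIntegrable_const (huI _ _),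
    intervalIntegral.integral_const, smul_eq_mul] at hstrict
  have := mul_pos hγ hstrict
  nlinarith

lemma aux_refl_mem (q ℓ : ℝ) (u : ℝ → ℝ) (hℓ : 0 < ℓ) (h : MemW01d q ℓ u) :
    MemW01d q ℓ (fun x => u (-x)) := by
  obtain ⟨hud, hul, hur, huq, hui⟩ := h
  have hle : -ℓ ≤ ℓ := by linarith
  have toI : ∀ f : ℝ → ℝ, Integrable f (volume.restrict (Ioo (-ℓ) ℓ)) ↔
      IntervalIntegrable f volume (-ℓ) ℓ := fun f =>
    (intervalIntegrable_iff_integrableOn_Ioo_of_le hle).symm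
  refine ⟨hud.comp differentiable_neg, by simpa using hur, by simpa using hul, ?_, ?_⟩
  · rw [toI] at huq ⊢
    have := ((IntervalIntegrable.iff_comp_neg (by finiteness)).1 huq).symm
    simpa [deriv_comp_neg] using this
  · rw [toI] at hui ⊢
    have := ((IntervalIntegrable.iff_comp_neg (by finiteness)).1 hui).symm
    simpa using this

lemma aux_refl_energy (F : ℝ → ℝ) (γ ℓ : ℝ) (hℓ : 0 < ℓ) (u : ℝ → ℝ) :
    energy1 (fun ξ => F (-ξ)) γ ℓ (fun x => u (-x)) = energy1 F γ ℓ u := by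
  have hle : -ℓ ≤ ℓ := by linarith
  unfold energy1
  rw [← integral_Ioc_eq_integral_Ioo, ← integral_Ioc_eq_integral_Ioo,
    ← intervalIntegral.integral_of_le hle, ← intervalIntegral.integral_of_le hle]
  have := intervalIntegral.integral_comp_neg (a := -ℓ) (b := ℓ)
    (fun x => F (deriv u x) - γ * u x)
  rw [neg_neg] at this
  rw [← this]
  simp [deriv_comp_neg]

/-- **Lemma (monotonicity of the 1D minimizer).** If `γ > 0` and `x₀ ∈ [−ℓ,ℓ]` is a maximum
point of the minimizer `u` over `[−ℓ,ℓ]`, then `u` is non-decreasing on `(−ℓ, x₀)` and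
non-increasing on `(x₀, ℓ)`. -/
theorem one_dim_monotonicity (q lam Lam γ ℓ : ℝ)
    (hq : 1 < q) (hlam : 0 < lam) (hLam : 0 < Lam) (hγ : 0 < γ) (hℓ : 0 < ℓ)
    (F : ℝ → ℝ)
    (hFgrowth : ∀ ξ : ℝ, lam * |ξ| ^ q ≤ F ξ ∧ F ξ ≤ Lam * |ξ| ^ q)
    (u : ℝ → ℝ)
    (hu : IsMinOn1d (MemW01d q ℓ) (energy1 F γ ℓ) u)
    (hupos : ∀ x ∈ Ioo (-ℓ) ℓ, 0 ≤ u x)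
    (x₀ : ℝ) (hx₀ : x₀ ∈ Icc (-ℓ) ℓ) (hmax : IsMaxOn u (Icc (-ℓ) ℓ) x₀) :
    MonotoneOn u (Ioo (-ℓ) x₀) ∧ AntitoneOn u (Ioo x₀ ℓ) := by

  refine ⟨aux_mono q lam Lam γ ℓ hq hlam hLam hγ hℓ F hFgrowth u hu hupos x₀ hx₀ hmax, ?_⟩
  have h := aux_mono q lam Lam γ ℓ hq hlam hLam hγ hℓ (fun ξ => F (-ξ))
    (fun ξ => by simpa using hFgrowth (-ξ)) (fun x => u (-x))
    ⟨aux_refl_mem q ℓ u hℓ hu.1, fun v hv => by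
      rw [aux_refl_energy F γ ℓ hℓ u]
      have h1 := hu.2 _ (aux_refl_mem q ℓ v hℓ hv)
      rw [← aux_refl_energy F γ ℓ hℓ (fun x => v (-x))] at h1
      simpa using h1⟩
    (fun x hx => hupos (-x) ⟨by linarith [hx.2], by linarith [hx.1]⟩)
    (-x₀) ⟨by linarith [hx₀.2], by linarith [hx₀.1]⟩
    (fun x hx => by
      have : u (-x) ≤ u x₀ := hmax ⟨by linarith [hx.2], by linarith [hx.1]⟩
      simpa using this)
  intro x hx y hy hxy
  have := h (a := -y) ⟨by linarith [hy.2], by linarith [hy.1]⟩ (b := -x)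
    ⟨by linarith [hx.2], by linarith [hx.1]⟩ (by linarith)
  simpa using this
end
end

section
/- Let Ω_ℓ = (−ℓ, ℓ) ⊂ ℝ, γ > 0, and for each ℓ let u_ℓ be a minimizer of E_{Ω_ℓ}(u) = ∫_{−ℓ}^{ℓ} F(u') − γu over W₀^{1,q}(Ω_ℓ). Then u_ℓ(x) → +∞ as ℓ → ∞ pointwise for every x ∈ ℝ, and for every fixed a < b and every s > 0 one has ∫_a^b u_ℓ^s → +∞ as ℓ → ∞. -/
open MeasureTheory Set

noncomputable section

/-- a.e. countably valued -/
def CVal (k : ℝ → ℝ) : Prop := ∃ S : Set ℝ, S.Countable ∧ ∀ᵐ t, k t ∈ S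

lemma CVal.op2 {f g : ℝ → ℝ} (φ : ℝ → ℝ → ℝ) (hf : CVal f) (hg : CVal g) :
    CVal (fun t => φ (f t) (g t)) := by
  obtain ⟨S, hS, h1⟩ := hf
  obtain ⟨T, hT, h2⟩ := hg
  refine ⟨Set.image2 φ S T, hS.image2 hT φ, ?_⟩
  filter_upwards [h1, h2] with t a b
  exact Set.mem_image2_of_mem a b

lemma CVal.comp_sub {f : ℝ → ℝ} (hf : CVal f) (c : ℝ) : CVal (fun t => f (c - t)) := by
  obtain ⟨S, hS, h1⟩ := hf
  exact ⟨S, hS, (Measure.measurePreserving_sub_left volume c).quasiMeasurePreserving.ae h1⟩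

lemma CVal.aesm {k : ℝ → ℝ} (hk : CVal k) (hm : Measurable k) (F : ℝ → ℝ) :
    AEStronglyMeasurable (fun t => F (k t)) volume := by
  obtain ⟨S, hS, h1⟩ := hk
  have hI : Measurable (S.indicator F) := by
    refine (measurable_zero (α := ℝ) (β := ℝ)).measurable_of_countable_ne (hS.mono ?_)
    intro x hx
    by_contra h
    exact hx (by simp [h])
  refine (hI.comp hm).aestronglyMeasurable.congr ?_
  filter_upwards [h1] with t ht
  simp [ht]

lemma exists_atomic : ∃ (ν : Measure (Icc (0:ℝ) 1)) (D : Set (Icc (0:ℝ) 1)), D.Countable ∧ Dense D ∧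
    ν univ = 1 ∧ ν D = 1 ∧ ∀ d ∈ D, ν {d} ≠ 0 := by
  let e := TopologicalSpace.denseSeq (Icc (0:ℝ) 1)
  let ν : Measure (Icc (0:ℝ) 1) := Measure.sum fun n : ℕ => ((2:ENNReal)⁻¹ ^ (n+1)) • Measure.dirac (e n)
  have hs : ∑' n : ℕ, ((2:ENNReal)⁻¹ ^ (n+1)) = 1 := by
    rw [← ENNReal.tsum_two_zpow_neg_add_one]
    congr 1
    ext n
    rw [show (-1 - (n:ℤ)) = -((n+1 : ℕ) : ℤ) by push_cast; ring, ENNReal.zpow_neg, zpow_natCast, ENNReal.inv_pow]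
  refine ⟨ν, range e, countable_range e, TopologicalSpace.denseRange_denseSeq _, ?_, ?_, ?_⟩
  · rw [Measure.sum_apply _ MeasurableSet.univ]
    simpa using hs
  · rw [Measure.sum_apply _ (countable_range e).measurableSet]
    simpa using hs
  · rintro _ ⟨n, rfl⟩ h
    rw [Measure.sum_apply _ (measurableSet_singleton _), ENNReal.tsum_eq_zero] at h
    have := h n
    simp at this

lemma exists_cantor : ∃ h : ℝ → ℝ, Continuous h ∧ (∀ t, 0 ≤ h t) ∧ (∀ t, h t ≤ 1) ∧
    (∀ t ≤ 0, h t = 0) ∧ (∀ t, 2 ≤ t → h t = 1) ∧ CVal h := by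
  obtain ⟨ν, D, hDc, hDd, hu, hD, hpos⟩ := exists_atomic
  have : IsProbabilityMeasure ν := ⟨hu⟩
  let J : Icc (0:ℝ) 1 → ℝ := fun y => ν.real (Iic y)
  let g : ℝ → Icc (0:ℝ) 1 := fun t => sInf {y | t ≤ J y}
  have gm : Monotone g := fun s t hst => sInf_le_sInf fun y hy => le_trans hst hy
  have key : ∀ d, Ioo (ν.real (Iio d)) (ν.real (Iic d)) ⊆ g ⁻¹' {d} := by
    rintro d t ⟨h1, h2⟩
    refine le_antisymm (sInf_le h2.le) (le_sInf fun y hy => ?_)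
    by_contra hlt
    push Not at hlt
    have : J y ≤ ν.real (Iio d) := measureReal_mono (fun z hz => lt_of_le_of_lt hz hlt)
    have hy' : t ≤ J y := hy
    linarith
  have hlen : ∀ d, ν.real (Iic d) - ν.real (Iio d) = ν.real {d} := by
    intro d
    have : Iic d = Iio d ∪ {d} := by
      ext z; simp [le_iff_lt_or_eq]
    rw [this, measureReal_union (by simp) (measurableSet_singleton d)]; ring
  have gc : Continuous g := by
    refine gm.continuous_of_denseRange (hDd.mono ?_)
    intro d hd
    have h0 : 0 < ν.real {d} := by
      rw [measureReal_def, ENNReal.toReal_pos_iff]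
      exact ⟨pos_iff_ne_zero.mpr (hpos d hd), measure_lt_top _ _⟩
    obtain ⟨t, ht⟩ := exists_between (show ν.real (Iio d) < ν.real (Iic d) by linarith [hlen d])
    exact ⟨t, key d ht⟩
  have hg0 : ∀ t ≤ 0, g t = ⊥ := by
    intro t ht
    have : {y | t ≤ J y} = univ := by
      ext y; simp only [mem_ofPred_eq, mem_univ, iff_true]
      exact ht.trans measureReal_nonneg
    simp [g, this]
  have hg1 : ∀ t, 1 < t → g t = ⊤ := by
    intro t ht
    have : {y | t ≤ J y} = ∅ := by
      ext y; simp only [mem_ofPred_eq, mem_empty_iff_false, iff_false, not_le]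
      exact lt_of_le_of_lt measureReal_le_one ht
    simp [g, this]
  have hmeas : ∀ᵐ t, t ∈ Ioo (0:ℝ) 1 → g t ∈ D := by
    have hB : MeasurableSet (g ⁻¹' D) := gc.measurable hDc.measurableSet
    have h1 : 1 ≤ volume (Ioo (0:ℝ) 1 ∩ g ⁻¹' D) := by
      have e1 : ν D = ∑' d : D, ν {(d : Icc (0:ℝ) 1)} := by
        rw [← measure_biUnion hDc (fun a _ b _ hab => by simpa [Function.onFun] using hab) (fun d _ => measurableSet_singleton d)]
        simp
      have e2 : ∑' d : D, volume (Ioo (0:ℝ) 1 ∩ g ⁻¹' {(d : Icc (0:ℝ) 1)}) = volume (Ioo (0:ℝ) 1 ∩ g ⁻¹' D) := by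
        rw [← measure_biUnion (f := fun d => Ioo (0:ℝ) 1 ∩ g ⁻¹' {d}) hDc]
        · congr 1
          ext t
          simp only [mem_iUnion, mem_inter_iff, mem_preimage, mem_singleton_iff, exists_prop]
          exact ⟨fun ⟨d, hd, h1, h2⟩ => ⟨h1, h2 ▸ hd⟩, fun ⟨h1, h2⟩ => ⟨_, h2, h1, rfl⟩⟩
        · intro a _ b _ hab
          refine Disjoint.mono inter_subset_right inter_subset_right ?_
          exact Disjoint.preimage g (by simpa using hab)
        · intro d _
          exact measurableSet_Ioo.inter (gc.measurable (measurableSet_singleton d))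
      rw [← e2, ← hD, e1]
      refine ENNReal.tsum_le_tsum fun d => ?_
      have : Ioo (ν.real (Iio d.1)) (ν.real (Iic d.1)) ⊆ Ioo (0:ℝ) 1 ∩ g ⁻¹' {d.1} := by
        refine subset_inter ?_ (key _)
        exact Ioo_subset_Ioo measureReal_nonneg measureReal_le_one
      refine le_trans ?_ (measure_mono this)
      rw [Real.volume_Ioo, hlen, ofReal_measureReal]
    have h2 : volume (Ioo (0:ℝ) 1 \ g ⁻¹' D) = 0 := by
      have := measure_inter_add_sdiff (μ := volume) (Ioo (0:ℝ) 1) hB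
      rw [Real.volume_Ioo] at this
      simp only [sub_zero, ENNReal.ofReal_one] at this
      by_contra hne
      have h3 : (1 : ENNReal) + 0 < volume (Ioo (0:ℝ) 1 ∩ g ⁻¹' D) + volume (Ioo (0:ℝ) 1 \ g ⁻¹' D) := 
        ENNReal.add_lt_add_of_le_of_lt (by simp) h1 (pos_iff_ne_zero.mpr hne)
      rw [this] at h3
      simp at h3
    rw [ae_iff]
    convert h2 using 2
    ext t; simp [and_assoc]
  refine ⟨fun t => (g t : ℝ), continuous_subtype_val.comp gc, fun t => (g t).2.1, fun t => (g t).2.2, 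
    fun t ht => by simp [hg0 t ht], fun t ht => by simp [hg1 t (by linarith)], ?_⟩
  refine ⟨Subtype.val '' (D ∪ {⊥, ⊤}), ((hDc.union (by simp)).image _), ?_⟩
  filter_upwards [hmeas, Measure.ae_ne volume (1:ℝ)] with t ht ht1
  refine mem_image_of_mem _ ?_
  rcases le_or_gt t 0 with h | h
  · simp [hg0 t h]
  rcases lt_or_gt_of_ne ht1 with h' | h'
  · exact Or.inl (ht ⟨h, h'⟩)
  · simp [hg1 t h']

lemma exists_ramp (M : ℝ) (hM : 0 ≤ M) : ∃ C > 0, ∀ L ≥ C, ∀ y m p : ℝ, 0 ≤ m → m ≤ M → |p| ≤ M →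
    ∃ w k : ℝ → ℝ, (∀ t, HasDerivAt w (k t) t) ∧ Continuous k ∧ CVal k ∧ (∀ t, |k t| ≤ M + 2) ∧
      w y = m ∧ k y = p ∧ w (y - L) = 0 ∧
      ∀ t ∈ Icc (y - L) y, (y - t) * (t - (y - L)) / L - C ≤ w t := by
  obtain ⟨h, hc, h0, h1, hl, hr, hcv⟩ := exists_cantor
  let H : ℝ → ℝ := fun t => ∫ s in (0:ℝ)..t, h s
  have hi : ∀ a b, IntervalIntegrable h volume a b := fun a b => hc.intervalIntegrable a b
  have HD : ∀ t, HasDerivAt H (h t) t := fun t => (hc.integral_hasStrictDerivAt 0 t).hasDerivAt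
  have Hneg : ∀ t ≤ 0, H t = 0 := by
    intro t ht
    have : ∫ s in (0:ℝ)..t, h s = ∫ s in (0:ℝ)..t, (0:ℝ) := by
      refine intervalIntegral.integral_congr fun s hs => ?_
      rw [uIcc_of_ge ht] at hs
      exact hl s hs.2
    simpa [H] using this
  have Hnn : ∀ t, 0 ≤ t → 0 ≤ H t := fun t ht =>
    intervalIntegral.integral_nonneg ht fun s _ => h0 s
  have Hle : ∀ t, 0 ≤ t → H t ≤ t := by
    intro t ht
    have : H t ≤ ∫ s in (0:ℝ)..t, (1:ℝ) :=
      intervalIntegral.integral_mono_on ht (hi _ _) (by simp) fun s _ => h1 s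
    simpa using this
  have Hbig : ∀ t, 2 ≤ t → H t = t - 2 + H 2 := by
    intro t ht
    have e1 : H 2 + ∫ s in (2:ℝ)..t, h s = H t := intervalIntegral.integral_add_adjacent_intervals (hi _ _) (hi _ _)
    have : ∫ s in (2:ℝ)..t, h s = ∫ s in (2:ℝ)..t, (1:ℝ) := by
      refine intervalIntegral.integral_congr fun s hs => ?_
      rw [uIcc_of_le ht] at hs
      exact hr s hs.1
    rw [this] at e1
    simp at e1
    linarith
  have Hge : ∀ t, 0 ≤ t → t - 2 ≤ H t := by
    intro t ht
    rcases le_total t 2 with h | h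
    · linarith [Hnn t ht]
    · linarith [Hbig t h, Hnn 2 (by norm_num)]
  have k0 := Hnn 2 (by norm_num)
  have k2 := Hle 2 (by norm_num)
  refine ⟨5 * M + 6, by positivity, fun L hL y m p hm hmM hp => ?_⟩
  obtain ⟨hp1, hp2⟩ := abs_le.mp hp
  obtain ⟨e, he⟩ : ∃ e, e = 2 - H 2 := ⟨_, rfl⟩
  have he0 : 0 ≤ e := by linarith
  have he2 : e ≤ 2 := by linarith
  have hpe : p * e ≤ 2 * M := by nlinarith
  have hpe' : -(2 * M) ≤ p * e := by nlinarith
  obtain ⟨a, ha⟩ : ∃ a, a = (L - m - e + p * e) / 2 := ⟨_, rfl⟩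
  have ha0 : 0 ≤ a := by rw [ha]; linarith
  refine ⟨fun t => m - p * (y - t) + (p + 1) * H (y - t) - 2 * H (y - a - t),
    fun t => p - (p + 1) * h (y - t) + 2 * h (y - a - t), ?_, ?_, ?_, ?_, ?_, ?_, ?_, ?_⟩
  · intro t
    have d1 : HasDerivAt (fun t => y - t) (-1) t := by simpa using (hasDerivAt_id t).const_sub y
    have d2 : HasDerivAt (fun t => y - a - t) (-1) t := by simpa using (hasDerivAt_id t).const_sub (y - a)
    have D1 := (HD (y - t)).comp t d1
    have D2 := (HD (y - a - t)).comp t d2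
    have := (((d1.const_mul p).const_sub m).add (D1.const_mul (p+1))).sub (D2.const_mul 2)
    refine this.congr_deriv ?_
    ring
  · fun_prop
  · exact CVal.op2 (fun A B => p - (p + 1) * A + 2 * B) (hcv.comp_sub y) (hcv.comp_sub (y - a))
  · intro t
    have A0 := h0 (y - t)
    have A1 := h1 (y - t)
    have B0 := h0 (y - a - t)
    have B1 := h1 (y - a - t)
    rw [abs_le]
    constructor <;> nlinarith
  · simp [Hneg (-a) (by linarith), Hneg 0 le_rfl, show y - a - y = -a by ring]
  · simp [hl (-a) (by linarith), hl 0 le_rfl, show y - a - y = -a by ring]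
  · simp only [show y - (y - L) = L by ring, show y - a - (y - L) = L - a by ring]
    rw [Hbig L (by linarith), Hbig (L - a) (by rw [ha]; linarith), show H 2 = 2 - e by linarith]
    rw [ha]; ring
  · rintro t ⟨ht1, ht2⟩
    obtain ⟨τ, hτ⟩ : ∃ τ, τ = y - t := ⟨_, rfl⟩
    simp only [show y - a - t = τ - a by rw [hτ]; ring, show t - (y - L) = L - τ by rw [hτ]; ring, ← hτ]
    have τ0 : 0 ≤ τ := by linarith
    have τL : τ ≤ L := by linarith
    have Lpos : 0 < L := by linarith
    have q1 : τ * (L - τ) / L ≤ τ := by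
      rw [div_le_iff₀ Lpos]; nlinarith
    have q2 : τ * (L - τ) / L ≤ L - τ := by
      rw [div_le_iff₀ Lpos]; nlinarith
    have r1 := Hge τ τ0
    have r2 := Hle τ τ0
    have r3 : p * (τ - H τ) ≤ 2 * M := by nlinarith
    have r4 : H (τ - a) = 0 ∨ H (τ - a) ≤ τ - a := by
      rcases le_total (τ - a) 0 with h | h
      · exact Or.inl (Hneg _ h)
      · exact Or.inr (Hle _ h)
    rcases r4 with r | r
    · rw [r]; linarith
    · linarith

lemma exists_competitor (q Lam γ : ℝ) (hq : 1 < q) (hLam : 0 < Lam) (hγ : 0 < γ) (M : ℝ) (hM : 0 ≤ M) :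
    ∃ L₁ > 0, ∀ F : ℝ → ℝ, (∀ ξ, 0 ≤ F ξ ∧ F ξ ≤ Lam * |ξ| ^ q) →
    ∀ L ≥ L₁, ∀ y m p : ℝ, 0 ≤ m → m ≤ M → |p| ≤ M →
    ∃ w k : ℝ → ℝ, (∀ t, HasDerivAt w (k t) t) ∧ Continuous k ∧ 
      w y = m ∧ k y = p ∧ w (y - L) = 0 ∧ IntegrableOn (fun t => F (k t)) (Ioo (y - L) y) ∧
      ∫ t in Ioo (y - L) y, (F (k t) - γ * w t) < - (γ * M * L) := by
  obtain ⟨C, hC, hramp⟩ := exists_ramp M hM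
  set K := Lam * (M + 2) ^ q with hK
  have hK0 : 0 < K := by positivity
  refine ⟨6 * (K / γ + C + M) + 1 + C, by positivity, fun F hF L hL y m p hm hmM hp => ?_⟩
  have hKγ : 0 < K / γ := by positivity
  have hLC : C ≤ L := by nlinarith
  have hL0 : 0 < L := by linarith
  obtain ⟨w, k, hw, hk, hcv, hkb, hwy, hky, hw0, hlow⟩ := hramp L hLC y m p hm hmM hp
  have hbd : ∀ t, F (k t) ≤ K := fun t => (hF _).2.trans <| by
    rw [hK]
    gcongr
    exact hkb t
  have hFi : IntegrableOn (fun t => F (k t)) (Ioo (y - L) y) := by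
    refine Measure.integrableOn_of_bounded (M := K) (by simp) (hcv.aesm hk.measurable F) ?_
    filter_upwards with t
    rw [Real.norm_of_nonneg (hF _).1]
    exact hbd t
  refine ⟨w, k, hw, hk, hwy, hky, hw0, hFi, ?_⟩
  have hwc : Continuous w := continuous_iff_continuousAt.mpr fun t => (hw t).continuousAt
  have hwi : IntegrableOn w (Ioo (y - L) y) :=
    (hwc.integrableOn_Icc).mono_set Ioo_subset_Icc_self
  have hpi : IntegrableOn (fun t => K - γ * ((y - t) * (t - (y - L)) / L - C)) (Ioo (y - L) y) := 
    ((show Continuous (fun t => K - γ * ((y - t) * (t - (y - L)) / L - C)) by fun_prop).integrableOn_Icc).mono_set Ioo_subset_Icc_self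
  have hle : ∫ t in Ioo (y - L) y, (F (k t) - γ * w t) ≤ 
      ∫ t in Ioo (y - L) y, (K - γ * ((y - t) * (t - (y - L)) / L - C)) := by
    refine setIntegral_mono_on (hFi.sub (hwi.const_mul γ)) hpi measurableSet_Ioo fun t ht => ?_
    have := mul_le_mul_of_nonneg_left (hlow t (Ioo_subset_Icc_self ht)) hγ.le
    linarith [hbd t]
  have hval : ∫ t in Ioo (y - L) y, (K - γ * ((y - t) * (t - (y - L)) / L - C)) = 
      K * L - γ * (L ^ 2 / 6 - C * L) := by
    rw [← integral_Ioc_eq_integral_Ioo, ← intervalIntegral.integral_of_le (by linarith)]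
    have hd : ∀ t ∈ uIcc (y - L) y, HasDerivAt (fun t => K * t + γ * C * t - γ / L * (L * (t - (y - L)) ^ 2 / 2 - (t - (y - L)) ^ 3 / 3))
        (K - γ * ((y - t) * (t - (y - L)) / L - C)) t := by
      intro t _
      have d1 : HasDerivAt (fun t => t - (y - L)) 1 t := (hasDerivAt_id t).sub_const _
      have d0 := hasDerivAt_id t
      have := ((d0.const_mul K).add (d0.const_mul (γ * C))).sub
        (((((d1.pow 2).const_mul L).div_const 2).sub ((d1.pow 3).div_const 3)).const_mul (γ / L))
      refine this.congr_deriv ?_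
      simp
      field_simp
      ring
    rw [intervalIntegral.integral_eq_sub_of_hasDerivAt hd 
      ((show Continuous (fun t => K - γ * ((y - t) * (t - (y - L)) / L - C)) by fun_prop).intervalIntegrable _ _)]
    field_simp
    ring
  refine hle.trans_lt ?_
  rw [hval]
  have hkk : K = γ * (K / γ) := by field_simp
  have : 6 * (K / γ + C + M) < L := by linarith
  have h2 := mul_lt_mul_of_pos_left this (mul_pos hγ hL0)
  have h3 : γ * L * (6 * (K / γ + C + M)) = 6 * (K * L) + 6 * γ * C * L + 6 * γ * M * L := by
    field_simp
  nlinarith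

lemma left_bound (q Lam γ : ℝ) (hq : 1 < q) (hLam : 0 < Lam) (hγ : 0 < γ) (x M : ℝ) (hM : 0 ≤ M) :
    ∃ ℓ₀ > 0, ∀ F : ℝ → ℝ, (∀ ξ, 0 ≤ F ξ ∧ F ξ ≤ Lam * |ξ| ^ q) →
    ∀ ℓ ≥ ℓ₀, ∀ u : ℝ → ℝ, IsMinOn1d (MemW01d q ℓ) (energy1 F γ ℓ) u →
      (∀ t ∈ Ioo (-ℓ) ℓ, 0 ≤ u t) → (∀ t ∈ Ioo (-ℓ) x, u t ≤ u x) → M ≤ u x := by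
  obtain ⟨L₁, hL₁, hcomp⟩ := exists_competitor q Lam γ hq hLam hγ M hM
  refine ⟨L₁ + |x| + 2, by positivity, fun F hF ℓ hℓ u hu hpos hmax => ?_⟩
  by_contra hlt
  push Not at hlt
  have hx1 := neg_abs_le x
  have hx2 := le_abs_self x
  have hx0 := abs_nonneg x
  obtain ⟨⟨hud, hul, hur, huq, hui⟩, hmin⟩ := hu
  have hIq : ∀ k : ℝ → ℝ, Continuous k → ∀ a b, IntegrableOn (fun t => |k t| ^ q) (Ioo a b) := by
    intro k hk a b
    refine ((hk.abs.rpow_const fun t => Or.inr (by linarith)).integrableOn_Icc).mono_set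
      Ioo_subset_Icc_self
  -- the energy of `u` is negative, so the energy density is integrable
  have hint : IntegrableOn (fun t => F (deriv u t) - γ * u t) (Ioo (-ℓ) ℓ) := by
    by_contra hni
    have hE : energy1 F γ ℓ u = 0 := integral_undef hni
    obtain ⟨w, k, hw, hk, hwy, hky, hw0, hFi, hen⟩ := hcomp F hF (2 * ℓ) (by linarith) ℓ 0 0 le_rfl hM
      (by simpa using hM)
    rw [show ℓ - 2 * ℓ = -ℓ by ring] at *
    have hdw : deriv w = k := funext fun t => (hw t).deriv
    have hwd : Differentiable ℝ w := fun t => (hw t).differentiableAt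
    have := hmin w ⟨hwd, hw0, hwy, by rw [hdw]; exact hIq k hk _ _,
      (hwd.continuous.integrableOn_Icc).mono_set Ioo_subset_Icc_self⟩
    rw [hE, energy1, hdw] at this
    have h3 : 0 ≤ γ * M * (2 * ℓ) := by
      have : 0 ≤ ℓ := by linarith
      positivity
    linarith
  have hFu : IntegrableOn (fun t => F (deriv u t)) (Ioo (-ℓ) ℓ) := by
    have := hint.add (hui.const_mul γ)
    refine this.congr ?_
    filter_upwards with t
    simp
  -- gluing point
  obtain ⟨y, ⟨hy1, hy2⟩, hy⟩ := exists_deriv_eq_slope u (show x - 1 < x by linarith)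
    hud.continuous.continuousOn hud.differentiableOn
  have hp : |deriv u y| ≤ M := by
    rw [hy, show x - (x - 1) = 1 by ring, div_one, abs_le]
    have a1 := hpos x ⟨by linarith, by linarith⟩
    have a2 := hpos (x - 1) ⟨by linarith, by linarith⟩
    have a3 := hmax (x - 1) ⟨by linarith, by linarith⟩
    constructor <;> linarith
  have hm0 := hpos y ⟨by linarith, by linarith⟩
  have hmM : u y ≤ M := (hmax y ⟨by linarith, hy2⟩).trans hlt.le
  have hyl : -ℓ < y := by linarith
  have hyr : y < ℓ := by linarith
  obtain ⟨w, k, hw, hk, hwy, hky, hw0, hFi, hen⟩ := hcomp F hF (y + ℓ) (by linarith) y (u y) (deriv u y)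
    hm0 hmM hp
  rw [show y - (y + ℓ) = -ℓ by ring] at *
  let v : ℝ → ℝ := fun t => if t ≤ y then w t else u t
  have v1 : ∀ t ≤ y, v t = w t := fun t ht => by simp [v, ht]
  have v2 : ∀ t, y ≤ t → v t = u t := fun t ht => by
    rcases ht.eq_or_lt with rfl | h
    · simp [v, hwy]
    · simp [v, not_le.mpr h]
  have hvl : ∀ t < y, HasDerivAt v (k t) t := fun t ht =>
    (hw t).congr_of_eventuallyEq (by
      filter_upwards [Iio_mem_nhds ht] with s hs using v1 s (le_of_lt hs))
  have hvr : ∀ t, y < t → HasDerivAt v (deriv u t) t := fun t ht =>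
    (hud t).hasDerivAt.congr_of_eventuallyEq (by
      filter_upwards [Ioi_mem_nhds ht] with s hs using v2 s (le_of_lt hs))
  have hvy : HasDerivAt v (k y) y := by
    have A : HasDerivWithinAt v (k y) (Iic y) y :=
      (hw y).hasDerivWithinAt.congr (fun s hs => v1 s hs) (v1 y le_rfl)
    have B : HasDerivWithinAt v (k y) (Ici y) y := by
      rw [hky]
      exact (hud y).hasDerivAt.hasDerivWithinAt.congr (fun s hs => v2 s hs) (v2 y le_rfl)
    have := A.union B
    rwa [Iic_union_Ici, hasDerivWithinAt_univ] at this
  have hvd : Differentiable ℝ v := fun t => by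
    rcases lt_trichotomy t y with h | h | h
    · exact (hvl t h).differentiableAt
    · rw [h]; exact hvy.differentiableAt
    · exact (hvr t h).differentiableAt
  have hsplit : Ioo (-ℓ) ℓ = Ioo (-ℓ) y ∪ Ico y ℓ := (Ioo_union_Ico_eq_Ioo hyl hyr.le).symm
  have hdisj : Disjoint (Ioo (-ℓ) y) (Ico y ℓ) := by
    rw [Set.disjoint_left]
    intro t h1 h2
    exact absurd h1.2 (not_lt.mpr h2.1)
  have hdr : ∀ t ∈ Ico y ℓ, deriv v t = deriv u t := by
    intro t ht
    rcases ht.1.eq_or_lt with h | h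
    · rw [← h, hvy.deriv, hky]
    · exact (hvr t h).deriv
  have hdl : ∀ t ∈ Ioo (-ℓ) y, deriv v t = k t := fun t ht => (hvl t ht.2).deriv
  have hsubl : Ioo (-ℓ) y ⊆ Ioo (-ℓ) ℓ := by rw [hsplit]; exact subset_union_left
  have hsubr : Ico y ℓ ⊆ Ioo (-ℓ) ℓ := by rw [hsplit]; exact subset_union_right
  have hwc : Continuous w := continuous_iff_continuousAt.mpr fun t => (hw t).continuousAt
  have hwi : IntegrableOn w (Ioo (-ℓ) y) := (hwc.integrableOn_Icc).mono_set Ioo_subset_Icc_self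
  have hvq : IntegrableOn (fun t => |deriv v t| ^ q) (Ioo (-ℓ) ℓ) := by
    rw [hsplit]
    refine IntegrableOn.union ?_ ?_
    · exact (hIq k hk (-ℓ) y).congr_fun (fun t ht => by simp [hdl t ht]) measurableSet_Ioo
    · exact (IntegrableOn.mono_set huq hsubr).congr_fun (fun t ht => by simp [hdr t ht]) measurableSet_Ico
  have hE := hmin v ⟨hvd, by rw [v1 _ hyl.le, hw0], by rw [v2 _ hyr.le, hur], hvq,
    (hvd.continuous.integrableOn_Icc).mono_set Ioo_subset_Icc_self⟩
  have hl : EqOn (fun t => F (deriv v t) - γ * v t) (fun t => F (k t) - γ * w t) (Ioo (-ℓ) y) :=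
    fun t ht => by simp only [hdl t ht, v1 t ht.2.le]
  have hr : EqOn (fun t => F (deriv v t) - γ * v t) (fun t => F (deriv u t) - γ * u t) (Ico y ℓ) :=
    fun t ht => by simp only [hdr t ht, v2 t ht.1]
  have hvil : IntegrableOn (fun t => F (deriv v t) - γ * v t) (Ioo (-ℓ) y) :=
    (IntegrableOn.congr_fun (hFi.sub (hwi.const_mul γ)) hl.symm measurableSet_Ioo)
  have hvir : IntegrableOn (fun t => F (deriv v t) - γ * v t) (Ico y ℓ) :=
    (IntegrableOn.congr_fun (hint.mono_set hsubr) hr.symm measurableSet_Ico)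
  rw [energy1, energy1, hsplit, setIntegral_union hdisj measurableSet_Ico hvil hvir,
    setIntegral_union hdisj measurableSet_Ico (hint.mono_set hsubl) (hint.mono_set hsubr),
    setIntegral_congr_fun measurableSet_Ioo hl, setIntegral_congr_fun measurableSet_Ico hr] at hE
  have hlow : ∫ t in Ioo (-ℓ) y, (-(γ * M)) ≤ ∫ t in Ioo (-ℓ) y, (F (deriv u t) - γ * u t) := by
    refine setIntegral_mono_on (integrableOn_const (by simp)) (hint.mono_set hsubl) measurableSet_Ioo fun t ht => ?_
    have h1 : u t ≤ M := (hmax t ⟨ht.1, ht.2.trans hy2⟩).trans hlt.le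
    have h2 := mul_le_mul_of_nonneg_left h1 hγ.le
    linarith [(hF (deriv u t)).1]
  rw [setIntegral_const, Real.volume_real_Ioo_of_le hyl.le, smul_eq_mul] at hlow
  have : (y - -ℓ) * -(γ * M) = -(γ * M * (y + ℓ)) := by ring
  linarith

lemma integrable_neg_Ioo {f : ℝ → ℝ} {ℓ : ℝ} (hf : IntegrableOn f (Ioo (-ℓ) ℓ)) :
    IntegrableOn (fun t => f (-t)) (Ioo (-ℓ) ℓ) := by
  have := ((Measure.measurePreserving_neg (volume : Measure ℝ)).integrableOn_comp_preimage
    (Homeomorph.neg ℝ).measurableEmbedding (f := f) (s := Ioo (-ℓ) ℓ)).mpr hf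
  simpa [Function.comp_def] using this

lemma memW_neg {q ℓ : ℝ} {u : ℝ → ℝ} (h : MemW01d q ℓ u) : MemW01d q ℓ (fun t => u (-t)) := by
  obtain ⟨h1, h2, h3, h4, h5⟩ := h
  refine ⟨h1.comp differentiable_neg, by simpa using h3, by simpa using h2, ?_, integrable_neg_Ioo h5⟩
  have := integrable_neg_Ioo h4
  refine this.congr ?_
  filter_upwards with t
  rw [deriv_comp_neg, abs_neg]

lemma energy_neg (F : ℝ → ℝ) (γ ℓ : ℝ) (u : ℝ → ℝ) :
    energy1 (fun ξ => F (-ξ)) γ ℓ (fun t => u (-t)) = energy1 F γ ℓ u := by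
  have := (Measure.measurePreserving_neg (volume : Measure ℝ)).setIntegral_preimage_emb
    (Homeomorph.neg ℝ).measurableEmbedding (fun t => F (deriv u t) - γ * u t) (Ioo (-ℓ) ℓ)
  rw [energy1, energy1, ← this]
  simp [deriv_comp_neg]

lemma isMin_neg {F : ℝ → ℝ} {q γ ℓ : ℝ} {u : ℝ → ℝ}
    (h : IsMinOn1d (MemW01d q ℓ) (energy1 F γ ℓ) u) :
    IsMinOn1d (MemW01d q ℓ) (energy1 (fun ξ => F (-ξ)) γ ℓ) (fun t => u (-t)) := by
  refine ⟨memW_neg h.1, fun v hv => ?_⟩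
  have e1 := h.2 _ (memW_neg hv)
  have e2 := energy_neg F γ ℓ (fun t => v (-t))
  simp only [neg_neg] at e2
  rw [energy_neg, e2]
  exact e1

/-- **Theorem (blow-up of the 1D minimizers).** If `γ > 0` then `u_ℓ(x) → +∞` as `ℓ → ∞`
pointwise for every `x ∈ ℝ`, and for all fixed `a < b` and every `s > 0`,
`∫_a^b u_ℓ^s → +∞`. -/
theorem one_dim_blow_up (q lam Lam γ : ℝ)
    (hq : 1 < q) (hlam : 0 < lam) (hLam : 0 < Lam) (hγ : 0 < γ)
    (F : ℝ → ℝ)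
    (hFgrowth : ∀ ξ : ℝ, lam * |ξ| ^ q ≤ F ξ ∧ F ξ ≤ Lam * |ξ| ^ q)
    (u : ℝ → ℝ → ℝ)
    (hu : ∀ ℓ > 0, IsMinOn1d (MemW01d q ℓ) (energy1 F γ ℓ) (u ℓ))
    (hupos : ∀ ℓ > 0, ∀ x ∈ Ioo (-ℓ) ℓ, 0 ≤ u ℓ x)
    (hunimodal : ∀ ℓ > 0, ∃ x₀ ∈ Icc (-ℓ) ℓ, IsMaxOn (u ℓ) (Icc (-ℓ) ℓ) x₀ ∧
      MonotoneOn (u ℓ) (Ioo (-ℓ) x₀) ∧ AntitoneOn (u ℓ) (Ioo x₀ ℓ)) :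
    (∀ x : ℝ, Filter.Tendsto (fun ℓ => u ℓ x) Filter.atTop Filter.atTop) ∧
    (∀ a b s : ℝ, a < b → 0 < s →
      Filter.Tendsto (fun ℓ => ∫ x in Ioo a b, u ℓ x ^ s) Filter.atTop Filter.atTop) := by
  have hF : ∀ ξ, 0 ≤ F ξ ∧ F ξ ≤ Lam * |ξ| ^ q := fun ξ =>
    ⟨le_trans (by positivity) (hFgrowth ξ).1, (hFgrowth ξ).2⟩
  have hF' : ∀ ξ, 0 ≤ F (-ξ) ∧ F (-ξ) ≤ Lam * |ξ| ^ q := fun ξ => by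
    simpa using hF (-ξ)
  have key : ∀ x M : ℝ, 0 ≤ M → ∀ᶠ ℓ in Filter.atTop, M ≤ u ℓ x := by
    intro x M hM
    obtain ⟨ℓ₁, h1, H1⟩ := left_bound q Lam γ hq hLam hγ x M hM
    obtain ⟨ℓ₂, h2, H2⟩ := left_bound q Lam γ hq hLam hγ (-x) M hM
    filter_upwards [Filter.eventually_ge_atTop ℓ₁, Filter.eventually_ge_atTop ℓ₂,
      Filter.eventually_gt_atTop |x|] with ℓ hℓ1 hℓ2 hℓx
    have hℓ : 0 < ℓ := by linarith
    obtain ⟨hxl, hxr⟩ := abs_lt.mp hℓx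
    obtain ⟨x₀, hx₀, hmax, hmono, hanti⟩ := hunimodal ℓ hℓ
    rcases le_total x x₀ with hx | hx
    · refine H1 F hF ℓ hℓ1 (u ℓ) (hu ℓ hℓ) (hupos ℓ hℓ) fun t ht => ?_
      rcases hx.eq_or_lt with h | h
      · rw [h]
        exact hmax ⟨ht.1.le, by linarith [ht.2]⟩
      · exact hmono ⟨ht.1, by linarith [ht.2]⟩ ⟨hxl, h⟩ ht.2.le
    · have := H2 (fun ξ => F (-ξ)) hF' ℓ hℓ2 (fun t => u ℓ (-t)) (isMin_neg (hu ℓ hℓ))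
        (fun t ht => hupos ℓ hℓ (-t) ⟨by linarith [ht.2], by linarith [ht.1]⟩) (fun t ht => ?_)
      · simpa using this
      · simp only [neg_neg]
        rcases hx.eq_or_lt with h | h
        · rw [← h]
          exact hmax ⟨by linarith [ht.2], by linarith [ht.1]⟩
        · exact hanti ⟨h, hxr⟩ ⟨by linarith [ht.2], by linarith [ht.1]⟩ (by linarith [ht.2])
  refine ⟨fun x => ?_, fun a b s hab hs => ?_⟩
  · rw [Filter.tendsto_atTop]
    intro M
    filter_upwards [key x (max M 0) (le_max_right _ _)] with ℓ h using (le_max_left _ _).trans h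
  · rw [Filter.tendsto_atTop]
    intro B
    have hba : 0 < b - a := by linarith
    obtain ⟨M, hM, hMB⟩ : ∃ M : ℝ, 0 ≤ M ∧ B ≤ (b - a) * M ^ s := by
      refine ⟨(max B 0 / (b - a)) ^ s⁻¹, by positivity, ?_⟩
      rw [Real.rpow_inv_rpow (by positivity) hs.ne', mul_div_cancel₀ _ hba.ne']
      exact le_max_left _ _
    filter_upwards [key a M hM, key b M hM, Filter.eventually_gt_atTop |a|,
      Filter.eventually_gt_atTop |b|] with ℓ ha hb hla hlb
    have hℓ : 0 < ℓ := (abs_nonneg a).trans_lt hla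
    obtain ⟨ha1, ha2⟩ := abs_lt.mp hla
    obtain ⟨hb1, hb2⟩ := abs_lt.mp hlb
    obtain ⟨x₀, hx₀, hmax, hmono, hanti⟩ := hunimodal ℓ hℓ
    have hlow : ∀ t ∈ Ioo a b, M ≤ u ℓ t := by
      intro t ht
      rcases lt_trichotomy t x₀ with h | h | h
      · exact ha.trans (hmono ⟨ha1, ht.1.trans h⟩ ⟨ha1.trans ht.1, h⟩ ht.1.le)
      · rw [h]
        exact ha.trans (hmax ⟨ha1.le, ha2.le⟩)
      · exact hb.trans (hanti ⟨h, ht.2.trans hb2⟩ ⟨h.trans ht.2, hb2⟩ ht.2.le)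
    have hc : Continuous (u ℓ) := (hu ℓ hℓ).1.1.continuous
    have hi : IntegrableOn (fun x => u ℓ x ^ s) (Ioo a b) :=
      ((hc.rpow_const fun t => Or.inr hs.le).integrableOn_Icc).mono_set Ioo_subset_Icc_self
    have hle : ∫ x in Ioo a b, M ^ s ≤ ∫ x in Ioo a b, u ℓ x ^ s :=
      setIntegral_mono_on (by simp) hi measurableSet_Ioo fun t ht =>
        Real.rpow_le_rpow hM (hlow t ht) hs.le
    rw [setIntegral_const, Real.volume_real_Ioo_of_le hab.le, smul_eq_mul] at hle
    exact hMB.trans hle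
end
end
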